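/- Let 1 < p < p₁ ≤ ∞ and θ ∈ (0,1) with 1/p = (1-θ) + θ/p₁. Then for every f ∈ L^p(μ) on the weighted homogeneous tree and every t > 0, the K-functional satisfies K(t, f; H¹(μ), L^{p₁}(μ)) ≤ C t^θ ‖f‖_{L^p}, with C independent of f and t; consequently f ∈ [H¹(μ), L^{p₁}(μ)]_{θ,∞} with ‖f‖_{θ,∞} ≤ C‖f‖_{L^p}. -/

import Mathlib

open scoped ENNReal NNReal
open MeasureTheory Filter

/-- An infinite homogeneous tree of order `q+1`: a connected acyclic graph in which
every vertex has exactly `q+1` neighbours, equipped with a doubly-infinite geodesic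
`geo : ℤ → V` (the labelling `N` is the inverse of `geo`) and the associated level
function `lev`, satisfying `lev (geo i) = i`, changing by `±1` along edges, and such
that every vertex has exactly one neighbour lying directly above it. -/
structure HomTree (q : ℕ) where
  V : Type
  G : SimpleGraph V
  conn : G.Connected
  acyclic : G.IsAcyclic
  degree : ∀ v : V, (G.neighborSet v).ncard = q + 1
  lev : V → ℤ
  geo : ℤ → V
  geo_dist : ∀ i j : ℤ, G.dist (geo i) (geo j) = (i - j).natAbs
  lev_geo : ∀ i : ℤ, lev (geo i) = i
  lev_adj : ∀ v w : V, G.Adj v w → lev w = lev v + 1 ∨ lev w = lev v - 1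
  unique_above : ∀ v : V, ∃! w : V, G.Adj v w ∧ lev w = lev v + 1

namespace HomTree

variable {q : ℕ}

/-- Graph distance on the tree. -/
noncomputable def dist (T : HomTree q) (x y : T.V) : ℕ := T.G.dist x y

/-- `x` lies below `y`. -/
def below (T : HomTree q) (x y : T.V) : Prop := T.lev x = T.lev y - T.dist x y

/-- The weighted measure `μ(A) = ∑_{x ∈ A} q^{ℓ(x)}`. -/
noncomputable def mu (T : HomTree q) (A : Set T.V) : ℝ≥0∞ :=
  ∑' x : A, (q : ℝ≥0∞) ^ (T.lev x.1)

def sphere (T : HomTree q) (x₀ : T.V) (r : ℕ) : Set T.V := {x | T.dist x x₀ = r}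

def ball (T : HomTree q) (x₀ : T.V) (r : ℕ) : Set T.V := {x | T.dist x x₀ ≤ r}

/-- An admissible trapezoid: either a degenerate singleton `{root}` (with height 1), or
the set of vertices below the root spanning levels `[h, 2h)` under it. -/
structure Trapezoid (T : HomTree q) where
  root : T.V
  height : ℕ
  degenerate : Bool
  height_pos : 1 ≤ height
  deg_height : degenerate = true → height = 1

namespace Trapezoid

variable {T : HomTree q}

/-- The vertex set of the admissible trapezoid. -/
def set (R : T.Trapezoid) : Set T.V :=
  if R.degenerate then {R.root}
  else {x | T.below x R.root ∧ (R.height : ℤ) ≤ T.lev R.root - T.lev x ∧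
        T.lev R.root - T.lev x < 2 * (R.height : ℤ)}

/-- The envelope (Calderón–Zygmund set) of the admissible trapezoid:
vertices below the root with `h/2 ≤ ℓ(x_R) - ℓ(x) < 4h`. -/
def envelope (R : T.Trapezoid) : Set T.V :=
  if R.degenerate then {R.root}
  else {x | T.below x R.root ∧ (R.height : ℤ) ≤ 2 * (T.lev R.root - T.lev x) ∧
        T.lev R.root - T.lev x < 4 * (R.height : ℤ)}

/-- The width `w(R) = q^{ℓ(x_R)}`. -/
noncomputable def width (R : T.Trapezoid) : ℝ≥0∞ := (q : ℝ≥0∞) ^ (T.lev R.root)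

/-- The dilated set `R̃* = {x : d(x, R̃) < h(R̃)/4}`. -/
def dilate (R : T.Trapezoid) : Set T.V :=
  {x | ∃ y ∈ R.envelope, 4 * T.dist x y < R.height}

end Trapezoid

/-- `‖f‖_{L^p(μ)}^p = ∑_x |f(x)|^p q^{ℓ(x)}`. -/
noncomputable def lpPow (T : HomTree q) (f : T.V → ℂ) (p : ℝ) : ℝ≥0∞ :=
  ∑' x : T.V, (‖f x‖₊ : ℝ≥0∞) ^ p * (q : ℝ≥0∞) ^ (T.lev x)

/-- `∫_A |f|^p dμ`. -/
noncomputable def setIntPow (T : HomTree q) (f : T.V → ℂ) (p : ℝ) (A : Set T.V) : ℝ≥0∞ :=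
  ∑' x : A, (‖f x.1‖₊ : ℝ≥0∞) ^ p * (q : ℝ≥0∞) ^ (T.lev x.1)

/-- `‖f‖_{L¹(μ)}`. -/
noncomputable def l1Norm (T : HomTree q) (f : T.V → ℂ) : ℝ≥0∞ :=
  ∑' x : T.V, (‖f x‖₊ : ℝ≥0∞) * (q : ℝ≥0∞) ^ (T.lev x)

/-- `‖f‖_{L²(μ)}`. -/
noncomputable def l2Norm (T : HomTree q) (f : T.V → ℂ) : ℝ≥0∞ :=
  (T.lpPow f 2) ^ (2⁻¹ : ℝ)

/-- `‖f‖_{L^{p}(μ)}` for `p ∈ ℝ≥0∞`, including `p = ∞`. -/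
noncomputable def lpNormE (T : HomTree q) (p : ℝ≥0∞) (f : T.V → ℂ) : ℝ≥0∞ :=
  if p = ⊤ then ⨆ x, (‖f x‖₊ : ℝ≥0∞) else (T.lpPow f p.toReal) ^ (p.toReal)⁻¹

/-- The trapezoidal maximal function of a nonnegative density `g`. -/
noncomputable def maxFn (T : HomTree q) (g : T.V → ℝ≥0∞) (x : T.V) : ℝ≥0∞ :=
  ⨆ (R : T.Trapezoid) (_ : x ∈ R.set),
    (∑' y : R.set, g y.1 * (q : ℝ≥0∞) ^ (T.lev y.1)) / T.mu R.set

/-- `a` is a `(1,∞)`-atom associated with the Calderón–Zygmund set `R̃`. -/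
def IsInftyAtomOn (T : HomTree q) (R : T.Trapezoid) (a : T.V → ℂ) : Prop :=
  Function.support a ⊆ R.envelope ∧
  (∀ x, (‖a x‖₊ : ℝ≥0∞) ≤ (T.mu R.envelope)⁻¹) ∧
  ∑' x : T.V, a x * (q : ℂ) ^ (T.lev x) = 0

/-- `a` is a `(1,∞)`-atom. -/
def IsInftyAtom (T : HomTree q) (a : T.V → ℂ) : Prop :=
  ∃ R : T.Trapezoid, T.IsInftyAtomOn R a

/-- `a` is a `(1,p)`-atom, `1 < p < ∞`: supported in a Calderón–Zygmund set `R̃`,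
`‖a‖_{L^p} ≤ μ(R̃)^{1/p-1}` (equivalently `‖a‖_{L^p}^p ≤ μ(R̃)^{1-p}`), vanishing integral. -/
def IspAtom (T : HomTree q) (p : ℝ) (a : T.V → ℂ) : Prop :=
  ∃ R : T.Trapezoid, Function.support a ⊆ R.envelope ∧
    T.lpPow a p ≤ (T.mu R.envelope) ^ (1 - p) ∧
    ∑' x : T.V, a x * (q : ℂ) ^ (T.lev x) = 0

/-- `h` belongs to the atomic Hardy space `H^{1,∞}(μ)`. -/
def InH1 (T : HomTree q) (h : T.V → ℂ) : Prop :=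
  ∃ (c : ℕ → ℂ) (a : ℕ → T.V → ℂ), (∀ n, T.IsInftyAtom (a n)) ∧
    Summable (fun n => ‖c n‖) ∧ ∀ x, HasSum (fun n => c n * a n x) (h x)

/-- The `H^{1,∞}(μ)` norm: infimum of `∑ |λ_j|` over atomic decompositions. -/
noncomputable def H1Norm (T : HomTree q) (h : T.V → ℂ) : ℝ≥0∞ :=
  ⨅ (c : ℕ → ℂ) (a : ℕ → T.V → ℂ)
    (_ : (∀ n, T.IsInftyAtom (a n)) ∧ ∀ x, HasSum (fun n => c n * a n x) (h x)),
    ∑' n, (‖c n‖₊ : ℝ≥0∞)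

/-- `h` belongs to the atomic Hardy space `H^{1,p}(μ)`. -/
def InH1p (T : HomTree q) (p : ℝ) (h : T.V → ℂ) : Prop :=
  ∃ (c : ℕ → ℂ) (a : ℕ → T.V → ℂ), (∀ n, T.IspAtom p (a n)) ∧
    Summable (fun n => ‖c n‖) ∧ ∀ x, HasSum (fun n => c n * a n x) (h x)

/-- The `H^{1,p}(μ)` norm. -/
noncomputable def H1pNorm (T : HomTree q) (p : ℝ) (h : T.V → ℂ) : ℝ≥0∞ :=
  ⨅ (c : ℕ → ℂ) (a : ℕ → T.V → ℂ)
    (_ : (∀ n, T.IspAtom p (a n)) ∧ ∀ x, HasSum (fun n => c n * a n x) (h x)),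
    ∑' n, (‖c n‖₊ : ℝ≥0∞)

/-- The K-functional for the couple `(H¹(μ), L^{p₁}(μ))`. -/
noncomputable def KH1Lp (T : HomTree q) (p₁ : ℝ≥0∞) (t : ℝ≥0∞) (f : T.V → ℂ) : ℝ≥0∞ :=
  ⨅ (b : T.V → ℂ) (g : T.V → ℂ) (_ : ∀ x, f x = b x + g x),
    T.H1Norm b + t * T.lpNormE p₁ g

/-- The real interpolation norm `‖f‖_{θ,pr}` for the couple `(H¹(μ), L^{p₁}(μ))`. -/
noncomputable def interpNorm (T : HomTree q) (p₁ : ℝ≥0∞) (θ pr : ℝ) (f : T.V → ℂ) : ℝ≥0∞ :=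
  (∫⁻ t in Set.Ioi (0 : ℝ),
      (T.KH1Lp p₁ (ENNReal.ofReal t) f / (ENNReal.ofReal t) ^ θ) ^ pr *
        (ENNReal.ofReal t)⁻¹) ^ (1 / pr)

/-- The distinguished Laplacian `ℒ`. -/
noncomputable def lap (T : HomTree q) (f : T.V → ℂ) (x : T.V) : ℂ :=
  f x - (1 / (2 * ((Real.sqrt q : ℝ) : ℂ))) *
    ∑' y : T.G.neighborSet x, ((Real.sqrt q : ℝ) : ℂ) ^ (T.lev y.1 - T.lev x) * f y.1

end HomTree

open HomTree

structure Dyad (V : Type) (w : V → ℝ) (C : ℝ) where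
  Q : ℕ → V → Finset V
  wpos : ∀ x, 0 < w x
  Cpos : 0 < C
  Q0 : ∀ x, Q 0 x = {x}
  Qself : ∀ n x, x ∈ Q n x
  Qeq : ∀ n x y, y ∈ Q n x → Q n y = Q n x
  Qmono : ∀ n x, Q n x ⊆ Q (n + 1) x
  Qreg : ∀ n x, ∑ y ∈ Q (n + 1) x, w y ≤ C * ∑ y ∈ Q n x, w y
  Qinf : ∀ x (M : ℝ), ∃ N : ℕ, ∀ n, N ≤ n → M ≤ ∑ y ∈ Q n x, w y

namespace Dyad

variable {V : Type} {w : V → ℝ} {C : ℝ} (D : Dyad V w C)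

noncomputable def m (n : ℕ) (x : V) : ℝ := ∑ y ∈ D.Q n x, w y

noncomputable def A {E : Type} [AddCommGroup E] [Module ℝ E] (n : ℕ) (f : V → E) (x : V) : E :=
  (D.m n x)⁻¹ • ∑ y ∈ D.Q n x, w y • f y

noncomputable def nu (F : V → ℝ) (s : ℝ) (x : V) : ℕ := sSup {n | s < D.A n F x}

lemma m_pos (n : ℕ) (x : V) : 0 < D.m n x :=
  Finset.sum_pos (fun y _ => D.wpos y) ⟨x, D.Qself n x⟩

lemma Qmono' {n k : ℕ} (h : n ≤ k) (x : V) : D.Q n x ⊆ D.Q k x := by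
  induction h with
  | refl => exact subset_rfl
  | step _ ih => exact ih.trans (D.Qmono _ x)

lemma A_eq {E : Type} [AddCommGroup E] [Module ℝ E] (n : ℕ) (f : V → E) {x y : V}
    (h : y ∈ D.Q n x) : D.A n f y = D.A n f x := by
  simp only [A, m, D.Qeq n x y h]

lemma A_eq' {E : Type} [AddCommGroup E] [Module ℝ E] {n k : ℕ} (hk : n ≤ k) (f : V → E) {x y : V}
    (h : y ∈ D.Q n x) : D.A k f y = D.A k f x := D.A_eq k f (D.Qmono' hk x h)

lemma A_zero {E : Type} [AddCommGroup E] [Module ℝ E] (f : V → E) (x : V) : D.A 0 f x = f x := by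
  have := (D.wpos x).ne'
  simp [A, m, D.Q0, smul_smul, this]

lemma A_nonneg {F : V → ℝ} (hF : ∀ x, 0 ≤ F x) (n : ℕ) (x : V) : 0 ≤ D.A n F x := by
  have := (D.m_pos n x).le
  exact mul_nonneg (inv_nonneg.2 this)
    (Finset.sum_nonneg fun y _ => mul_nonneg (D.wpos y).le (hF y))

lemma A_reg {F : V → ℝ} (hF : ∀ x, 0 ≤ F x) (n : ℕ) (x : V) :
    D.A n F x ≤ C * D.A (n + 1) F x := by
  have h1 := D.m_pos n x
  have h2 := D.m_pos (n+1) x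
  have h3 : D.m (n+1) x ≤ C * D.m n x := D.Qreg n x
  have h4 : ∑ y ∈ D.Q n x, w y * F y ≤ ∑ y ∈ D.Q (n+1) x, w y * F y :=
    Finset.sum_le_sum_of_subset_of_nonneg (D.Qmono n x)
      fun y _ _ => mul_nonneg (D.wpos y).le (hF y)
  have h5 : 0 ≤ ∑ y ∈ D.Q n x, w y * F y :=
    Finset.sum_nonneg fun y _ => mul_nonneg (D.wpos y).le (hF y)
  simp only [A, smul_eq_mul]
  have h6 : (D.m n x)⁻¹ ≤ C * (D.m (n+1) x)⁻¹ := by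
    rw [← div_eq_mul_inv, inv_eq_one_div, div_le_div_iff₀ h1 h2]; linarith
  calc _ ≤ (C * (D.m (n+1) x)⁻¹) * ∑ y ∈ D.Q n x, w y * F y := by gcongr
    _ ≤ (C * (D.m (n+1) x)⁻¹) * ∑ y ∈ D.Q (n+1) x, w y * F y := by
        have := D.Cpos
        gcongr
    _ = _ := by ring

lemma A_le {F : V → ℝ} (hF : ∀ x, 0 ≤ F x) (hs : Summable fun x => w x * F x) (n : ℕ) (x : V) :
    D.A n F x ≤ (D.m n x)⁻¹ * ∑' x, w x * F x := by
  have h1 := D.m_pos n x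
  simp only [A, smul_eq_mul]
  gcongr
  exact hs.sum_le_tsum _ fun y _ => mul_nonneg (D.wpos y).le (hF y)

lemma m_ge (n : ℕ) (x : V) : w x ≤ D.m n x :=
  Finset.single_le_sum (f := w) (fun y _ => (D.wpos y).le) (D.Qself n x)

section nu

lemma nu_bdd {F : V → ℝ} (hF : ∀ x, 0 ≤ F x) (hs : Summable fun x => w x * F x)
    {s : ℝ} (h0 : 0 < s) (x : V) : BddAbove {n | s < D.A n F x} := by
  obtain ⟨N, hN⟩ := D.Qinf x ((∑' x, w x * F x) / s)
  refine ⟨N, fun n hn => ?_⟩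
  by_contra hlt
  push Not at hlt
  have h1 : (∑' x, w x * F x) / s ≤ D.m n x := hN n hlt.le
  have h2 := D.A_le hF hs n x
  have h3 := D.m_pos n x
  have hn' : s < D.A n F x := hn
  rw [inv_mul_eq_div, le_div_iff₀ h3] at h2
  rw [div_le_iff₀ h0] at h1
  nlinarith

lemma lt_nu {F : V → ℝ} (hF : ∀ x, 0 ≤ F x) (hs : Summable fun x => w x * F x)
    {s : ℝ} (h0 : 0 < s) {x : V} {n : ℕ} (h : D.nu F s x < n) : D.A n F x ≤ s := by
  by_contra hc
  exact absurd (le_csSup (D.nu_bdd hF hs h0 x) (show n ∈ {n | s < D.A n F x} from not_le.1 hc))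
    (not_le.2 h)

lemma nu_pos_spec {F : V → ℝ} (_hF : ∀ x, 0 ≤ F x) {x : V} {s : ℝ} (hb : BddAbove {n | s < D.A n F x}) (h : D.nu F s x ≠ 0) :
    s < D.A (D.nu F s x) F x := by
  have hne : {n | s < D.A n F x}.Nonempty := by
    by_contra hc
    rw [Set.not_nonempty_iff_eq_empty] at hc
    exact h (by simp [nu, hc])
  exact Nat.sSup_mem hne hb

lemma nu_anti {F : V → ℝ} (hF : ∀ x, 0 ≤ F x) (hs : Summable fun x => w x * F x)
    {s s' : ℝ} (h0 : 0 < s) (h : s ≤ s') (x : V) : D.nu F s' x ≤ D.nu F s x := by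
  by_cases hz : D.nu F s' x = 0
  · omega
  · have := D.nu_pos_spec hF (D.nu_bdd hF hs (h0.trans_le h) x) hz
    exact le_csSup (D.nu_bdd hF hs h0 x) (h.trans_lt this)

lemma nu_eq {F : V → ℝ} (hF : ∀ x, 0 ≤ F x) (hs : Summable fun x => w x * F x)
    {s : ℝ} (h0 : 0 < s) {x y : V} (h : y ∈ D.Q (D.nu F s x) x) :
    D.nu F s y = D.nu F s x := by
  by_cases hz : D.nu F s x = 0
  · rw [hz, D.Q0, Finset.mem_singleton] at h
    rw [h]
  · have h1 := D.nu_pos_spec hF (D.nu_bdd hF hs h0 x) hz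
    rw [← D.A_eq _ F h] at h1
    have h2 : D.nu F s x ≤ D.nu F s y := le_csSup (D.nu_bdd hF hs h0 y) h1
    by_contra hne
    have h3 : D.nu F s y ≠ 0 := by omega
    have h4 := D.nu_pos_spec hF (D.nu_bdd hF hs h0 y) h3
    rw [D.A_eq' h2 F h] at h4
    have h5 : D.nu F s y ≤ D.nu F s x := le_csSup (D.nu_bdd hF hs h0 x) h4
    omega

lemma A_nu_le {F : V → ℝ} (hF : ∀ x, 0 ≤ F x) (hs : Summable fun x => w x * F x)
    {s : ℝ} (h0 : 0 < s) (x : V) : D.A (D.nu F s x) F x ≤ C * s := by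
  refine (D.A_reg hF _ x).trans ?_
  have := D.Cpos
  gcongr
  exact D.lt_nu hF hs h0 (Nat.lt_succ_self _)

lemma mem_symm {F : V → ℝ} (hF : ∀ x, 0 ≤ F x) (hs : Summable fun x => w x * F x)
    {s : ℝ} (h0 : 0 < s) {x y : V} (h : y ∈ D.Q (D.nu F s x) x) :
    x ∈ D.Q (D.nu F s y) y := by
  rw [D.nu_eq hF hs h0 h, D.Qeq _ _ _ h]
  exact D.Qself _ _

lemma sum_A {F : V → ℝ} (hF : ∀ x, 0 ≤ F x) (hs : Summable fun x => w x * F x)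
    {E : Type} [AddCommGroup E] [Module ℝ E] (f : V → E) {s : ℝ} (h0 : 0 < s)
    (S : Finset V) (hS : ∀ x ∈ S, D.Q (D.nu F s x) x ⊆ S) :
    ∑ x ∈ S, w x • D.A (D.nu F s x) f x = ∑ x ∈ S, w x • f x := by
  have h1 : ∀ x ∈ S, w x • D.A (D.nu F s x) f x =
      ∑ y ∈ D.Q (D.nu F s x) x, (w x * (D.m (D.nu F s y) y)⁻¹) • w y • f y := by
    intro x _
    rw [A, smul_smul, Finset.smul_sum]
    refine Finset.sum_congr rfl fun y hy => ?_
    have e := D.nu_eq hF hs h0 hy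
    have : D.m (D.nu F s y) y = D.m (D.nu F s x) x := by
      rw [e]; simp only [m, D.Qeq _ _ _ hy]
    rw [this]
  rw [Finset.sum_congr rfl h1]
  rw [Finset.sum_comm' (t' := S) (s' := fun y => D.Q (D.nu F s y) y)]
  · refine Finset.sum_congr rfl fun y _ => ?_
    rw [← Finset.sum_smul, ← Finset.sum_mul]
    have := (D.m_pos (D.nu F s y) y).ne'
    change (D.m (D.nu F s y) y * _) • _ = _
    rw [mul_inv_cancel₀ this, one_smul]
  · intro x y
    constructor
    · rintro ⟨hx, hy⟩
      exact ⟨D.mem_symm hF hs h0 hy, hS x hx hy⟩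
    · rintro ⟨hx, hy⟩
      exact ⟨hS y hy hx, D.mem_symm hF hs h0 hx⟩

lemma sum_A_le {F : V → ℝ} (hF : ∀ x, 0 ≤ F x) (hs : Summable fun x => w x * F x)
    {s : ℝ} (h0 : 0 < s) (S : Finset V) :
    ∑ x ∈ S, w x * D.A (D.nu F s x) F x ≤ ∑' x, w x * F x := by
  classical
  set S' := S.biUnion fun x => D.Q (D.nu F s x) x
  have hsub : S ⊆ S' := fun x hx => Finset.mem_biUnion.2 ⟨x, hx, D.Qself _ _⟩
  have := D.sum_A hF hs F h0 S' (by
    intro x hx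
    obtain ⟨y, hy, hxy⟩ := Finset.mem_biUnion.1 hx
    rw [D.nu_eq hF hs h0 hxy, D.Qeq _ _ _ hxy]
    exact Finset.subset_biUnion_of_mem (fun x => D.Q (D.nu F s x) x) hy)
  simp only [smul_eq_mul] at this
  calc _ ≤ ∑ x ∈ S', w x * D.A (D.nu F s x) F x :=
        Finset.sum_le_sum_of_subset_of_nonneg hsub
          fun y _ _ => mul_nonneg (D.wpos y).le (D.A_nonneg hF _ _)
    _ = _ := this
    _ ≤ _ := hs.sum_le_tsum _ fun y _ => mul_nonneg (D.wpos y).le (hF y)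

lemma nu_eventually {F : V → ℝ} (hF : ∀ x, 0 ≤ F x) (hs : Summable fun x => w x * F x)
    {s : ℕ → ℝ} (hsp : ∀ k, 0 < s k) (hst : Tendsto s atTop atTop) (x : V) :
    ∃ K, ∀ k, K ≤ k → D.nu F (s k) x = 0 := by
  obtain ⟨K, hK⟩ := (hst.eventually_ge_atTop ((w x)⁻¹ * ∑' x, w x * F x)).exists_forall_of_atTop
  refine ⟨K, fun k hk => ?_⟩
  by_contra hz
  have h1 := D.nu_pos_spec hF (D.nu_bdd hF hs (hsp k) x) hz
  have h2 := D.A_le hF hs (D.nu F (s k) x) x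
  have h3 := D.m_ge (D.nu F (s k) x) x
  have h4 : 0 ≤ ∑' x, w x * F x := tsum_nonneg fun y => mul_nonneg (D.wpos y).le (hF y)
  have h5 : (D.m (D.nu F (s k) x) x)⁻¹ ≤ (w x)⁻¹ := inv_anti₀ (D.wpos x) h3
  have := hK k hk
  nlinarith

end nu

lemma jensen (f : V → ℂ) {p : ℝ} (hp : 1 ≤ p) (n : ℕ) (x : V) :
    ‖D.A n f x‖ ^ p ≤ D.A n (fun y => ‖f y‖ ^ p) x := by
  have hm := D.m_pos n x
  have h1 := Real.rpow_arith_mean_le_arith_mean_rpow (D.Q n x) (fun y => (D.m n x)⁻¹ * w y)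
    (fun y => ‖f y‖) (fun y _ => mul_nonneg (inv_nonneg.2 hm.le) (D.wpos y).le)
    (by rw [← Finset.mul_sum]; exact inv_mul_cancel₀ hm.ne') (fun y _ => norm_nonneg _) hp
  have h2 : ‖D.A n f x‖ ≤ ∑ y ∈ D.Q n x, ((D.m n x)⁻¹ * w y) * ‖f y‖ := by
    rw [A, Finset.smul_sum]
    refine (norm_sum_le _ _).trans (Finset.sum_le_sum fun y _ => ?_)
    rw [smul_smul, norm_smul, Real.norm_of_nonneg (mul_nonneg (inv_nonneg.2 hm.le) (D.wpos y).le)]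
  calc _ ≤ _ := Real.rpow_le_rpow (norm_nonneg _) h2 (by linarith)
    _ ≤ _ := h1
    _ = _ := by
      simp only [A, smul_eq_mul, Finset.mul_sum, mul_assoc]

end Dyad
namespace Dyad

variable {V : Type} {w : V → ℝ} {C : ℝ} (D : Dyad V w C)

lemma beta_sigma {C s p : ℝ} (hC : 0 < C) (hs : 0 < s) (hp : 1 < p) (k : ℕ) :
    (2 * (C * (s * ((2:ℝ) ^ (k+1)) ^ p)) ^ (1/p)) * (s * ((2:ℝ)^k) ^ p)⁻¹ =
      4 * C ^ (1/p) * s ^ (1/p - 1) * ((2:ℝ) ^ (1 - p)) ^ k := by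
  have hp0 : p ≠ 0 := by linarith
  rw [Real.mul_rpow hC.le (by positivity), Real.mul_rpow hs.le (by positivity),
    ← Real.rpow_mul (by positivity), mul_one_div_cancel hp0, Real.rpow_one,
    Real.rpow_sub hs, Real.rpow_one, ← Real.rpow_natCast, ← Real.rpow_natCast,
    ← Real.rpow_natCast, ← Real.rpow_mul (by norm_num), ← Real.rpow_mul (by norm_num)]
  have e1 : (2:ℝ) ^ ((k+1 : ℕ) : ℝ) = 2 * 2 ^ (k:ℝ) := by
    push_cast
    rw [Real.rpow_add (by norm_num), Real.rpow_one]; ring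
  have e2 : (2:ℝ) ^ ((1-p) * k) = 2 ^ (k:ℝ) / 2 ^ ((k:ℝ) * p) := by
    rw [← Real.rpow_sub (by norm_num)]; congr 1; ring
  rw [e1, e2]
  have : (2:ℝ) ^ ((k:ℝ) * p) ≠ 0 := by positivity
  field_simp
  ring

theorem decomp (f : V → ℂ) {p : ℝ} (hp : 1 < p) {s : ℝ} (hs0 : 0 < s)
    (hsum : Summable fun x => w x * ‖f x‖ ^ p) :
    ∃ (g : V → ℂ) (c : ℕ × V → ℝ) (a : ℕ × V → V → ℂ) (n : ℕ × V → ℕ),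
      (∀ i, 0 ≤ c i) ∧ (∀ i, 1 ≤ n i) ∧ (∀ i x, x ∉ D.Q (n i) i.2 → a i x = 0) ∧
      (∀ i x, ‖a i x‖ ≤ (D.m (n i) i.2)⁻¹) ∧
      (∀ i, ∑ y ∈ D.Q (n i) i.2, w y • a i y = 0) ∧
      (∀ x, HasSum (fun i => (c i : ℂ) * a i x) (f x - g x)) ∧ Summable c ∧
      ∑' i, c i ≤ 4 * C ^ (1/p) / (1 - 2 ^ (1 - p)) * s ^ (1/p - 1) * ∑' x, w x * ‖f x‖ ^ p ∧
      (∀ x, ‖g x‖ ^ p ≤ C * s) ∧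
      ∀ S : Finset V, ∑ x ∈ S, w x * ‖g x‖ ^ p ≤ ∑' x, w x * ‖f x‖ ^ p := by
  classical
  set F : V → ℝ := fun y => ‖f y‖ ^ p with hFdef
  have hF : ∀ x, 0 ≤ F x := fun x => by positivity
  have hC := D.Cpos
  set σ : ℕ → ℝ := fun k => s * ((2:ℝ) ^ k) ^ p with hσ
  have hσ0 : ∀ k, 0 < σ k := fun k => by simp only [hσ]; positivity
  have hσs : ∀ k, σ k ≤ σ (k+1) := fun k => by
    simp only [hσ]
    gcongr
    · norm_num
    · omega
  have hσm : Monotone σ := monotone_nat_of_le_succ hσs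
  have hσt : Tendsto σ atTop atTop := by
    apply Tendsto.const_mul_atTop hs0
    exact (tendsto_rpow_atTop (by linarith)).comp (tendsto_pow_atTop_atTop_of_one_lt (by norm_num))
  set ν : ℕ → V → ℕ := fun k x => D.nu F (σ k) x with hν
  have hνeq : ∀ k {x y}, y ∈ D.Q (ν k x) x → ν k y = ν k x := fun k x y h =>
    D.nu_eq hF hsum (hσ0 k) h
  have hνm : ∀ {k l} x, k ≤ l → ν l x ≤ ν k x := fun {k l} x h =>
    D.nu_anti hF hsum (hσ0 k) (hσm h) x
  set G : ℕ → V → ℂ := fun k x => D.A (ν k x) f x with hG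
  set β : ℕ → ℝ := fun k => 2 * (C * σ (k+1)) ^ (1/p) with hβ
  have hβ0 : ∀ k, 0 < β k := fun k => by
    have := hσ0 (k+1)
    simp only [hβ]; positivity
  have hGp : ∀ k x, ‖G k x‖ ^ p ≤ D.A (ν k x) F x := fun k x => D.jensen f hp.le _ x
  have hGp' : ∀ k x, ‖G k x‖ ^ p ≤ C * σ k := fun k x =>
    (hGp k x).trans (D.A_nu_le hF hsum (hσ0 k) x)
  have hGb : ∀ k x, ‖G k x‖ ≤ (C * σ k) ^ (1/p) := fun k x => by
    rw [one_div, Real.le_rpow_inv_iff_of_pos (norm_nonneg _) (mul_nonneg hC.le (hσ0 k).le)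
      (by linarith)]
    exact hGp' k x
  have hGd : ∀ k x, ‖G (k+1) x - G k x‖ ≤ β k := fun k x => by
    have h1 := hGb (k+1) x
    have h2 := hGb k x
    have h3 : (C * σ k) ^ (1/p) ≤ (C * σ (k+1)) ^ (1/p) := by
      have := (hσ0 k).le
      have := hσs k
      gcongr
    have := norm_sub_le (G (k+1) x) (G k x)
    simp only [hβ]; linarith
  have hG0 : ∀ k x, ν k x = 0 → G k x = f x := fun k x h => by
    simp only [hG, h, D.A_zero]
  have hGint : ∀ k y, ∑ z ∈ D.Q (ν k y) y, w z • (G (k+1) z - G k z) = 0 := by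
    intro k y
    have key : ∀ l, k ≤ l → ∑ z ∈ D.Q (ν k y) y, w z • G l z =
        ∑ z ∈ D.Q (ν k y) y, w z • f z := by
      intro l hl
      apply D.sum_A hF hsum f (hσ0 l)
      intro x hx
      have h1 : D.Q (ν l x) x ⊆ D.Q (ν k x) x := D.Qmono' (hνm x hl) x
      rwa [hνeq k hx, D.Qeq _ _ _ hx] at h1
    simp only [smul_sub, Finset.sum_sub_distrib]
    rw [key (k+1) (by omega), key k le_rfl, sub_self]
  set c : ℕ × V → ℝ := fun i => if ν i.1 i.2 = 0 then 0 else β i.1 * w i.2 with hc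
  set a : ℕ × V → V → ℂ := fun i x => if ν i.1 i.2 = 0 then 0 else
    if x ∈ D.Q (ν i.1 i.2) i.2 then
      (β i.1 * D.m (ν i.1 i.2) i.2)⁻¹ • (G (i.1+1) x - G i.1 x) else 0 with ha
  have hc0 : ∀ i, 0 ≤ c i := fun i => by
    simp only [hc]
    split_ifs
    · exact le_rfl
    · exact mul_nonneg (hβ0 _).le (D.wpos _).le
  have hcs : ∀ S : Finset (ℕ × V), ∑ i ∈ S, c i ≤
      4 * C ^ (1/p) / (1 - 2 ^ (1 - p)) * s ^ (1/p - 1) * ∑' x, w x * ‖f x‖ ^ p := by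
    intro S
    have hN : 0 ≤ ∑' x, w x * F x := tsum_nonneg fun x => mul_nonneg (D.wpos x).le (hF x)
    have h1 : ∀ k, ∀ Y : Finset V, ∑ y ∈ Y, c (k, y) ≤ β k * (σ k)⁻¹ * ∑' x, w x * F x := by
      intro k Y
      have := hβ0 k
      have := hσ0 k
      calc _ ≤ ∑ y ∈ Y, β k * (σ k)⁻¹ * (w y * D.A (ν k y) F y) := by
            refine Finset.sum_le_sum fun y _ => ?_
            have hw := D.wpos y
            have hA := D.A_nonneg hF (ν k y) y
            simp only [hc]
            split_ifs with h
            · positivity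
            · have h2 : σ k ≤ D.A (ν k y) F y :=
                (D.nu_pos_spec hF (D.nu_bdd hF hsum (hσ0 k) y) h).le
              have h3 : 1 ≤ (σ k)⁻¹ * D.A (ν k y) F y := by
                rw [inv_mul_eq_div, one_le_div this]; exact h2
              calc β k * w y = (β k * w y) * 1 := by ring
                _ ≤ (β k * w y) * ((σ k)⁻¹ * D.A (ν k y) F y) := by gcongr
                _ = _ := by ring
        _ = β k * (σ k)⁻¹ * ∑ y ∈ Y, (w y * D.A (ν k y) F y) := by rw [Finset.mul_sum]
        _ ≤ _ := by
          gcongr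
          exact D.sum_A_le hF hsum (hσ0 k) Y
    have hr0 : (0:ℝ) ≤ 2 ^ (1 - p) := by positivity
    have hr1 : (2:ℝ) ^ (1 - p) < 1 := Real.rpow_lt_one_of_one_lt_of_neg (by norm_num) (by linarith)
    calc _ ≤ ∑ i ∈ (S.image Prod.fst) ×ˢ (S.image Prod.snd), c i :=
          Finset.sum_le_sum_of_subset_of_nonneg Finset.subset_product (fun i _ _ => hc0 i)
      _ = ∑ k ∈ S.image Prod.fst, ∑ y ∈ S.image Prod.snd, c (k, y) := Finset.sum_product _ _ _
      _ ≤ ∑ k ∈ S.image Prod.fst, β k * (σ k)⁻¹ * ∑' x, w x * F x :=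
          Finset.sum_le_sum fun k _ => h1 k _
      _ = (4 * C ^ (1/p) * s ^ (1/p - 1) * ∑' x, w x * F x) *
            ∑ k ∈ S.image Prod.fst, ((2:ℝ) ^ (1 - p)) ^ k := by
          rw [Finset.mul_sum]
          refine Finset.sum_congr rfl fun k _ => ?_
          rw [beta_sigma hC hs0 hp k]; ring
      _ ≤ (4 * C ^ (1/p) * s ^ (1/p - 1) * ∑' x, w x * F x) * (1 - 2 ^ (1 - p))⁻¹ := by
          gcongr
          rw [← tsum_geometric_of_lt_one hr0 hr1]
          exact (summable_geometric_of_lt_one hr0 hr1).sum_le_tsum _ fun k _ => by positivity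
      _ = _ := by ring
  refine ⟨G 0, c, a, fun i => max 1 (ν i.1 i.2), hc0, fun i => le_max_left _ _, ?_, ?_, ?_, ?_,
    summable_of_sum_le hc0 hcs, Real.tsum_le_of_sum_le hc0 hcs, ?_, ?_⟩
  · intro i x hx
    simp only [ha]
    split_ifs with h1 h2
    · rfl
    · have hmx : max 1 (ν i.1 i.2) = ν i.1 i.2 := max_eq_right (by omega)
      simp only [hmx] at hx
      exact absurd h2 hx
    · rfl
  · intro i x
    have hm0 := D.m_pos (max 1 (ν i.1 i.2)) i.2
    simp only [ha]
    split_ifs with h1 h2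
    · simpa using hm0.le
    · rw [max_eq_right (by omega)] at hm0 ⊢
      have := hβ0 i.1
      rw [norm_smul, Real.norm_of_nonneg (by positivity), mul_inv]
      calc _ ≤ (β i.1)⁻¹ * (D.m (ν i.1 i.2) i.2)⁻¹ * β i.1 := by
            gcongr
            exact hGd _ _
        _ = _ := by field_simp
    · simpa using hm0.le
  · intro i
    by_cases h1 : ν i.1 i.2 = 0
    · simp [ha, h1]
    · have hmx : max 1 (ν i.1 i.2) = ν i.1 i.2 := max_eq_right (by omega)
      simp only [hmx, ha, if_neg h1]
      rw [← smul_zero ((β i.1 * D.m (ν i.1 i.2) i.2)⁻¹), ← hGint i.1 i.2, Finset.smul_sum]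
      refine Finset.sum_congr rfl fun z hz => ?_
      rw [if_pos hz, smul_comm]
  · intro x
    obtain ⟨K, hK⟩ := D.nu_eventually hF hsum hσ0 hσt x
    have hsupp : ∀ i ∉ (Finset.range K) ×ˢ (D.Q (ν 0 x) x), (c i : ℂ) * a i x = 0 := by
      rintro ⟨k, y⟩ hi
      by_contra hne
      apply hi
      have h2 : a (k, y) x ≠ 0 := right_ne_zero_of_mul hne
      simp only [ha] at h2
      split_ifs at h2 with h3 h4
      · exact absurd rfl h2
      · have h5 := hνeq k h4
        have h6 : y ∈ D.Q (ν k x) x := D.mem_symm hF hsum (hσ0 k) h4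
        rw [Finset.mem_product, Finset.mem_range]
        refine ⟨?_, D.Qmono' (hνm x (Nat.zero_le k)) x h6⟩
        by_contra hk
        have : ν k x = 0 := hK k (by simpa using hk)
        omega
      · exact absurd rfl h2
    have := hasSum_sum_of_ne_finset_zero (L := SummationFilter.unconditional _) hsupp
    convert this using 1
    rw [Finset.sum_product]
    have hin : ∀ k ∈ Finset.range K, ∑ y ∈ D.Q (ν 0 x) x, (c (k, y) : ℂ) * a (k, y) x =
        G (k+1) x - G k x := by
      intro k _
      by_cases h0 : ν k x = 0
      · have h1 : ν (k+1) x = 0 := by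
          have := hνm (k := k) (l := k+1) x (by omega)
          omega
        rw [hG0 _ _ h0, hG0 _ _ h1, sub_self]
        refine Finset.sum_eq_zero fun y _ => ?_
        simp only [ha]
        split_ifs with h3 h4
        · simp
        · have h5 := hνeq k h4
          exact absurd (h5.symm.trans h0) h3
        · simp
      · rw [← Finset.sum_subset (D.Qmono' (hνm x (Nat.zero_le k)) x)]
        · have h1 : ∀ y ∈ D.Q (ν k x) x, (c (k, y) : ℂ) * a (k, y) x =
              w y • ((D.m (ν k x) x)⁻¹ • (G (k+1) x - G k x)) := by
            intro y hy
            have h2 := hνeq k hy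
            have h3 : x ∈ D.Q (ν k y) y := D.mem_symm hF hsum (hσ0 k) hy
            have h4 : D.m (ν k y) y = D.m (ν k x) x := by
              rw [h2]; simp only [m, D.Qeq _ _ _ hy]
            have h5 : ν k y ≠ 0 := by rw [h2]; exact h0
            simp only [hc, ha, if_neg h5, if_pos h3, h4]
            rw [← Complex.real_smul, smul_smul, smul_smul]
            congr 1
            have := (hβ0 k).ne'
            have := (D.m_pos (ν k x) x).ne'
            field_simp
          rw [Finset.sum_congr rfl h1, ← Finset.sum_smul, smul_smul]
          change (D.m (ν k x) x * _) • _ = _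
          rw [mul_inv_cancel₀ (D.m_pos (ν k x) x).ne', one_smul]
        · intro y _ hy
          simp only [ha]
          split_ifs with h3 h4
          · simp
          · exact absurd (D.mem_symm hF hsum (hσ0 k) h4) hy
          · simp
    rw [Finset.sum_congr rfl hin, Finset.sum_range_sub (fun k => G k x) K]
    congr 1
    exact (hG0 K x (hK K le_rfl)).symm
  · intro x
    have := hGp' 0 x
    simpa [hσ] using this
  · intro S
    refine le_trans (Finset.sum_le_sum fun x _ => ?_) (D.sum_A_le hF hsum (hσ0 0) S)
    exact mul_le_mul_of_nonneg_left (hGp 0 x) (D.wpos x).le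

end Dyad
namespace HomTree

variable {q : ℕ} (T : HomTree q)

noncomputable def up (x : T.V) : T.V := (T.unique_above x).choose

lemma up_adj (x : T.V) : T.G.Adj x (T.up x) := (T.unique_above x).choose_spec.1.1
lemma lev_up (x : T.V) : T.lev (T.up x) = T.lev x + 1 := (T.unique_above x).choose_spec.1.2
lemma up_unique {x y : T.V} (h : T.G.Adj x y) (hl : T.lev y = T.lev x + 1) : y = T.up x :=
  (T.unique_above x).choose_spec.2 y ⟨h, hl⟩

lemma lev_iter (k : ℕ) (x : T.V) : T.lev (T.up^[k] x) = T.lev x + k := by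
  induction k with
  | zero => simp
  | succ k ih => rw [Function.iterate_succ_apply', lev_up, ih]; push_cast; ring

lemma nbr_finite (r : T.V) : (T.G.neighborSet r).Finite := by
  apply Set.finite_of_ncard_ne_zero
  rw [T.degree]; omega

lemma nbr_eq (r : T.V) : T.G.neighborSet r = insert (T.up r) {y | T.up y = r} := by
  ext y
  simp only [SimpleGraph.mem_neighborSet, Set.mem_insert_iff, Set.mem_ofPred_eq]
  constructor
  · intro h
    rcases T.lev_adj r y h with h1 | h1
    · exact Or.inl (T.up_unique h h1)
    · exact Or.inr (T.up_unique h.symm (by omega)).symm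
  · rintro (h | h)
    · rw [h]; exact T.up_adj r
    · rw [← h]; exact (T.up_adj y).symm

lemma children_finite (r : T.V) : {y | T.up y = r}.Finite :=
  (T.nbr_finite r).subset (by rw [nbr_eq]; exact Set.subset_insert _ _)

noncomputable def children (r : T.V) : Finset T.V := (T.children_finite r).toFinset

lemma mem_children {r y : T.V} : y ∈ T.children r ↔ T.up y = r := by simp [children]

lemma card_children (r : T.V) : (T.children r).card = q := by
  have h := T.degree r
  rw [nbr_eq, Set.ncard_insert_of_notMem _ (T.children_finite r)] at h
  · rw [children, ← Set.ncard_eq_toFinset_card _ (T.children_finite r)]; omega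
  · intro h
    have h1 : T.up (T.up r) = r := h
    have h2 := T.lev_up (T.up r)
    rw [h1, T.lev_up] at h2
    omega

open Classical in
noncomputable def desc : ℕ → T.V → Finset T.V
  | 0, r => {r}
  | k + 1, r => (T.children r).biUnion (desc k)

lemma mem_desc {k : ℕ} {r y : T.V} : y ∈ T.desc k r ↔ T.up^[k] y = r := by
  induction k generalizing r with
  | zero => simp [desc]
  | succ k ih =>
    rw [Function.iterate_succ_apply']
    simp [desc, ih, mem_children]

lemma card_desc (k : ℕ) (r : T.V) : (T.desc k r).card = q ^ k := by
  classical
  induction k generalizing r with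
  | zero => simp [desc]
  | succ k ih =>
    rw [desc, Finset.card_biUnion]
    · simp [ih, card_children, pow_succ']
    · intro x _ y _ hxy
      rw [Function.onFun, Finset.disjoint_left]
      intro z hz1 hz2
      rw [mem_desc] at hz1 hz2
      exact hxy (hz1.symm.trans hz2)

noncomputable def wt (x : T.V) : ℝ := (q : ℝ) ^ (T.lev x)

lemma wt_pos (hq : 2 ≤ q) (x : T.V) : 0 < T.wt x := by
  have : (0:ℝ) < q := by exact_mod_cast (by omega : 0 < q)
  exact zpow_pos this _

lemma sum_desc (hq : 2 ≤ q) (k : ℕ) (r : T.V) : ∑ y ∈ T.desc k r, T.wt y = T.wt r := by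
  have h0 : (q:ℝ) ≠ 0 := by exact_mod_cast (by omega : q ≠ 0)
  have h1 : ∀ y ∈ T.desc k r, T.wt y = (q:ℝ) ^ (T.lev r - k) := by
    intro y hy
    rw [mem_desc] at hy
    rw [wt, ← hy, lev_iter]
    congr 1; ring
  rw [Finset.sum_congr rfl h1, Finset.sum_const, card_desc, nsmul_eq_mul, wt, zpow_sub₀ h0,
    zpow_natCast]
  push_cast
  field_simp

lemma walk_lev {x y : T.V} (p : T.G.Walk x y) :
    T.lev y - T.lev x ≤ p.length ∧ (T.lev y - T.lev x = p.length → T.up^[p.length] x = y) := by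
  induction p with
  | nil => simp
  | @cons u v w h p ih =>
    have := T.lev_adj u v h
    rw [SimpleGraph.Walk.length_cons]
    push_cast
    refine ⟨by omega, fun e => ?_⟩
    have h1 : T.lev v = T.lev u + 1 := by omega
    rw [Function.iterate_succ_apply, ← T.up_unique h h1]
    exact ih.2 (by omega)

lemma dist_iter (k : ℕ) (x : T.V) : T.dist x (T.up^[k] x) = k := by
  have h1 : T.dist x (T.up^[k] x) ≤ k := by
    induction k with
    | zero => simp [dist]
    | succ k ih =>
      rw [Function.iterate_succ_apply']
      have h2 : T.G.dist (T.up^[k] x) (T.up (T.up^[k] x)) = 1 :=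
        SimpleGraph.dist_eq_one_iff_adj.2 (T.up_adj _)
      have h3 := T.conn.dist_triangle (u := x) (v := T.up^[k] x) (w := T.up (T.up^[k] x))
      unfold dist at *
      omega
  obtain ⟨p, hp⟩ := T.conn.exists_walk_length_eq_dist x (T.up^[k] x)
  have h2 := (T.walk_lev p).1
  rw [lev_iter, hp] at h2
  unfold dist at *
  omega

lemma below_iff {x r : T.V} : T.below x r ↔ ∃ k : ℕ, T.up^[k] x = r := by
  constructor
  · intro h
    obtain ⟨p, hp⟩ := T.conn.exists_walk_length_eq_dist x r
    refine ⟨p.length, (T.walk_lev p).2 ?_⟩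
    unfold below dist at h
    rw [hp]; omega
  · rintro ⟨k, rfl⟩
    rw [below, dist_iter, lev_iter]; ring

lemma countableV : Countable T.V := by
  let S : ℕ → Set T.V := fun n => Nat.rec {T.geo 0} (fun _ s => ⋃ v ∈ s, T.G.neighborSet v) n
  have hS : ∀ n, (S n).Countable := by
    intro n
    induction n with
    | zero => exact Set.countable_singleton _
    | succ n ih => exact ih.biUnion fun v _ => (T.nbr_finite v).countable
  have hw : ∀ {x y : T.V} (p : T.G.Walk x y) (n : ℕ), x ∈ S n → ∃ m, y ∈ S m := by
    intro x y p
    induction p with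
    | nil => exact fun n h => ⟨n, h⟩
    | @cons u v w h p ih =>
      intro n hn
      exact ih (n+1) (Set.mem_biUnion hn h)
  have : (Set.univ : Set T.V) = ⋃ n, S n := by
    symm
    rw [Set.eq_univ_iff_forall]
    intro y
    obtain ⟨p⟩ := T.conn.preconnected (T.geo 0) y
    obtain ⟨m, hm⟩ := hw p 0 (Set.mem_singleton _)
    exact Set.mem_iUnion.2 ⟨m, hm⟩
  rw [← Set.countable_univ_iff, this]
  exact Set.countable_iUnion hS

/-! ### the dyadic system -/

/-- dyadic scale at stage `n` -/
def sc (n : ℕ) : ℤ := 2 ^ (Nat.log 2 n)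

/-- root level at stage `n` over level `l` -/
def rl (n : ℕ) (l : ℤ) : ℤ :=
  min ((l / sc n + 1) * sc n + sc n + 2 * (n - sc n)) ((l / (2 * sc n) + 1) * (2 * sc n) + 2 * sc n)

lemma sc_pos (n : ℕ) : 0 < sc n := by unfold sc; positivity

lemma sc_bounds {n : ℕ} (hn : 1 ≤ n) : sc n ≤ n ∧ (n:ℤ) < 2 * sc n := by
  have h1 := Nat.pow_log_le_self 2 (x := n) (by omega)
  have h2 := Nat.lt_pow_succ_log_self (b := 2) (by norm_num) n
  rw [pow_succ] at h2
  unfold sc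
  constructor
  · exact_mod_cast h1
  · have : ((n:ℕ):ℤ) < ((2 ^ Nat.log 2 n * 2 : ℕ) : ℤ) := by exact_mod_cast h2
    push_cast at this
    linarith

lemma sc_succ {n : ℕ} (hn : 1 ≤ n) :
    (sc (n+1) = sc n) ∨ (sc (n+1) = 2 * sc n ∧ (n:ℤ) + 1 = 2 * sc n) := by
  obtain ⟨h1, h2⟩ := sc_bounds hn
  rcases lt_or_eq_of_le (show (n:ℤ) + 1 ≤ 2 * sc n by omega) with h | h
  · left
    unfold sc at *
    have h3 : Nat.log 2 (n+1) = Nat.log 2 n := by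
      rw [Nat.log_eq_iff (Or.inr ⟨by norm_num, by omega⟩)]
      constructor
      · have := Nat.pow_log_le_self 2 (x := n) (by omega)
        omega
      · rw [pow_succ]; zify; linarith
    rw [h3]
  · right
    refine ⟨?_, h⟩
    unfold sc at *
    have h3 : Nat.log 2 (n+1) = Nat.log 2 n + 1 := by
      rw [Nat.log_eq_iff (Or.inr ⟨by norm_num, by omega⟩)]
      constructor
      · rw [pow_succ]; zify; linarith
      · rw [pow_succ, pow_succ]; zify
        have : (0:ℤ) < 2 ^ Nat.log 2 n := by positivity
        linarith
    rw [h3, pow_succ]; ring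

lemma div_facts (l : ℤ) {P : ℤ} (hP : 0 < P) :
    l < (l / P + 1) * P ∧ (l / P + 1) * P ≤ l + P := by
  have h1 := Int.emod_add_mul_ediv l P
  have h2 := Int.emod_nonneg l hP.ne'
  have h3 := Int.emod_lt_of_pos l hP
  constructor <;> nlinarith

lemma div_two (l : ℤ) {P : ℤ} (hP : 0 < P) :
    (l / P + 1) * P ≤ (l / (2 * P) + 1) * (2 * P) ∧
      (l / (2 * P) + 1) * (2 * P) ≤ (l / P + 1) * P + P := by
  have h1 : l / (2 * P) = l / P / 2 := by
    rw [mul_comm, Int.ediv_ediv_of_nonneg hP.le]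
  rw [h1]
  have h2 : l / P ≤ 2 * (l / P / 2) + 1 := by omega
  have h3 : 2 * (l / P / 2) ≤ l / P := by omega
  constructor <;> nlinarith

lemma rl_bounds {n : ℕ} (hn : 1 ≤ n) (l : ℤ) :
    (l / sc n + 1) * sc n + sc n ≤ rl n l ∧ rl n l ≤ (l / sc n + 1) * sc n + 3 * sc n := by
  have h0 := sc_pos n
  have h1 := sc_bounds hn
  have h2 := div_two l h0
  unfold rl
  constructor
  · apply le_min <;> linarith
  · apply (min_le_right _ _).trans; linarith

lemma rl_succ {n : ℕ} (hn : 1 ≤ n) (l : ℤ) : rl n l ≤ rl (n+1) l ∧ rl (n+1) l ≤ rl n l + 2 := by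
  have h0 := sc_pos n
  have h1 := sc_bounds hn
  have h2 := div_two l h0
  rcases sc_succ hn with h | ⟨h, h'⟩
  · unfold rl
    rw [h]
    push_cast
    omega
  · have h3 := div_two l (P := 2 * sc n) (by omega)
    unfold rl
    rw [h]
    push_cast
    omega

lemma rl_one (l : ℤ) : rl 1 l = l + 2 := by
  have h : sc 1 = 1 := by simp [sc]
  have := div_facts l (P := 2) (by norm_num)
  unfold rl
  rw [h]
  simp
  omega

lemma rl_ge {n : ℕ} (hn : 1 ≤ n) (l : ℤ) : l + sc n < rl n l := by
  have := rl_bounds hn l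
  have := div_facts l (sc_pos n)
  omega

lemma rl_congr {n : ℕ} {l l' : ℤ} (h : l / sc n = l' / sc n) : rl n l = rl n l' := by
  have h0 := sc_pos n
  unfold rl
  have : l / (2 * sc n) = l' / (2 * sc n) := by
    rw [mul_comm, ← Int.ediv_ediv_of_nonneg h0.le, ← Int.ediv_ediv_of_nonneg h0.le, h]
  rw [h, this]

/-- the root of the dyadic set of stage `n` containing `x` -/
noncomputable def rt (n : ℕ) (x : T.V) : T.V := T.up^[(rl n (T.lev x) - T.lev x).toNat] x

lemma lev_rt {n : ℕ} (hn : 1 ≤ n) (x : T.V) : T.lev (T.rt n x) = rl n (T.lev x) := by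
  rw [rt, lev_iter]
  have := rl_ge hn (T.lev x)
  have := sc_pos n
  omega

open Classical in
noncomputable def dQ (n : ℕ) (x : T.V) : Finset T.V :=
  if n = 0 then {x} else
    (Finset.range (sc n).toNat).biUnion fun i =>
      T.desc (rl n (T.lev x) - T.lev x / sc n * sc n - i).toNat (T.rt n x)

lemma mem_dQ {n : ℕ} (hn : 1 ≤ n) {x y : T.V} :
    y ∈ T.dQ n x ↔ T.lev y / sc n = T.lev x / sc n ∧ T.rt n y = T.rt n x := by
  have h0 := sc_pos n
  have hb := rl_bounds hn (T.lev x)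
  rw [add_mul, one_mul] at hb
  rw [dQ, if_neg (by omega)]
  simp only [Finset.mem_biUnion, Finset.mem_range, mem_desc]
  constructor
  · rintro ⟨i, hi, h⟩
    have hl := T.lev_iter (rl n (T.lev x) - T.lev x / sc n * sc n - i).toNat y
    rw [h, lev_rt T hn] at hl
    have hl2 : T.lev y = T.lev x / sc n * sc n + i := by omega
    have hd : T.lev y / sc n = T.lev x / sc n := by
      rw [hl2, add_comm, Int.add_mul_ediv_right _ _ h0.ne',
        Int.ediv_eq_zero_of_lt (by omega) (by omega)]
      ring
    refine ⟨hd, ?_⟩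
    rw [← h, rt, rl_congr hd, hl2]
    congr 1
    omega
  · rintro ⟨hd, h⟩
    have h1 := div_facts (T.lev y) h0
    rw [hd, add_mul, one_mul] at h1
    refine ⟨(T.lev y - T.lev x / sc n * sc n).toNat, by omega, ?_⟩
    rw [← h, rt, rl_congr hd]
    congr 1
    omega

lemma sum_dQ (hq : 2 ≤ q) {n : ℕ} (hn : 1 ≤ n) (x : T.V) :
    ∑ y ∈ T.dQ n x, T.wt y = (sc n : ℝ) * (q:ℝ) ^ (rl n (T.lev x)) := by
  classical
  have h0 := sc_pos n
  have hb := rl_bounds hn (T.lev x)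
  rw [add_mul, one_mul] at hb
  rw [dQ, if_neg (by omega), Finset.sum_biUnion]
  · simp only [sum_desc T hq, Finset.sum_const, Finset.card_range, nsmul_eq_mul]
    rw [wt, lev_rt T hn]
    congr 1
  · intro i hi j hj hij
    rw [Function.onFun, Finset.disjoint_left]
    intro z hz1 hz2
    rw [mem_desc] at hz1 hz2
    have e1 := T.lev_iter (rl n (T.lev x) - T.lev x / sc n * sc n - i).toNat z
    have e2 := T.lev_iter (rl n (T.lev x) - T.lev x / sc n * sc n - j).toNat z
    rw [hz1] at e1
    rw [hz2] at e2
    simp only [Finset.coe_range, Set.mem_Iio] at hi hj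
    omega

lemma rt_succ {n : ℕ} (hn : 1 ≤ n) (x : T.V) :
    T.rt (n+1) x = T.up^[(rl (n+1) (T.lev x) - rl n (T.lev x)).toNat] (T.rt n x) := by
  rw [rt, rt, ← Function.iterate_add_apply]
  congr 1
  have := rl_succ hn (T.lev x)
  have := rl_ge hn (T.lev x)
  have := sc_pos n
  omega

noncomputable def dyad (hq : 2 ≤ q) : Dyad T.V T.wt (2 * (q:ℝ) ^ 2) where
  Q := T.dQ
  wpos := T.wt_pos hq
  Cpos := by
    have : (0:ℝ) < q := by exact_mod_cast (by omega : 0 < q)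
    positivity
  Q0 x := by simp [dQ]
  Qself n x := by
    rcases Nat.eq_zero_or_pos n with rfl | hn
    · simp [dQ]
    · rw [mem_dQ T hn]; exact ⟨rfl, rfl⟩
  Qeq n x y h := by
    rcases Nat.eq_zero_or_pos n with rfl | hn
    · simp only [dQ, if_true, Finset.mem_singleton] at h
      rw [h]
    · rw [mem_dQ T hn] at h
      ext z
      rw [mem_dQ T hn, mem_dQ T hn, h.1, h.2]
  Qmono n x := by
    intro y hy
    rcases Nat.eq_zero_or_pos n with rfl | hn
    · simp only [dQ, if_true, Finset.mem_singleton] at hy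
      rw [hy, mem_dQ T (by omega)]; exact ⟨rfl, rfl⟩
    · rw [mem_dQ T hn] at hy
      have hd : T.lev y / sc (n+1) = T.lev x / sc (n+1) := by
        rcases sc_succ hn with h | ⟨h, _⟩
        · rw [h]; exact hy.1
        · have h0 := sc_pos n
          rw [h, mul_comm, ← Int.ediv_ediv_of_nonneg h0.le, ← Int.ediv_ediv_of_nonneg h0.le, hy.1]
      rw [mem_dQ T (by omega)]
      refine ⟨hd, ?_⟩
      rw [rt_succ T hn, rt_succ T hn, hy.2, rl_congr hd, rl_congr hy.1]
  Qreg n x := by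
    have hq0 : (0:ℝ) < q := by exact_mod_cast (by omega : 0 < q)
    have hq1 : (1:ℝ) ≤ q := by exact_mod_cast (by omega : 1 ≤ q)
    rw [sum_dQ T hq (by omega)]
    rcases Nat.eq_zero_or_pos n with rfl | hn
    · simp only [dQ, if_true, Finset.sum_singleton]
      rw [zero_add, rl_one, zpow_add₀ hq0.ne', wt]
      have : sc 1 = 1 := by simp [sc]
      rw [this]
      have : (0:ℝ) < (q:ℝ) ^ (T.lev x) := by positivity
      norm_cast
      norm_cast at this
      push_cast
      nlinarith [mul_pos this (pow_pos hq0 2)]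
    · rw [sum_dQ T hq hn]
      have h0 := sc_pos n
      have h1 : (sc (n+1) : ℝ) ≤ 2 * sc n := by
        have : sc (n+1) ≤ 2 * sc n := by rcases sc_succ hn with h | ⟨h, _⟩ <;> omega
        exact_mod_cast this
      have h2 : (q:ℝ) ^ (rl (n+1) (T.lev x)) ≤ (q:ℝ) ^ (rl n (T.lev x)) * (q:ℝ) ^ 2 := by
        have : (q:ℝ) ^ (rl n (T.lev x)) * (q:ℝ) ^ 2 = (q:ℝ) ^ (rl n (T.lev x) + 2) := by
          rw [zpow_add₀ hq0.ne']; norm_cast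
        rw [this]
        exact zpow_le_zpow_right₀ hq1 (rl_succ hn _).2
      have h3 : (0:ℝ) < sc n := by exact_mod_cast h0
      calc _ ≤ (2 * (sc n : ℝ)) * ((q:ℝ) ^ (rl n (T.lev x)) * (q:ℝ) ^ 2) := by gcongr
        _ = _ := by ring
  Qinf x M := by
    have hq1 : (1:ℝ) ≤ q := by exact_mod_cast (by omega : 1 ≤ q)
    have hw := T.wt_pos hq x
    obtain ⟨N, hN⟩ := exists_nat_ge (2 * M / T.wt x)
    refine ⟨N + 1, fun n hn => ?_⟩
    have hn1 : 1 ≤ n := by omega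
    rw [sum_dQ T hq hn1]
    have h1 : T.wt x ≤ (q:ℝ) ^ (rl n (T.lev x)) := by
      apply zpow_le_zpow_right₀ hq1
      have := rl_ge hn1 (T.lev x)
      have := sc_pos n
      omega
    have h2 : (N:ℝ) ≤ 2 * sc n := by
      have := (sc_bounds hn1).2
      have : (N:ℤ) ≤ 2 * sc n := by omega
      exact_mod_cast this
    have h3 : (0:ℝ) < sc n := by exact_mod_cast sc_pos n
    rw [div_le_iff₀ hw] at hN
    nlinarith

end HomTree
namespace HomTree

variable {q : ℕ} (T : HomTree q)

lemma ofReal_wt (hq : 2 ≤ q) (x : T.V) : (q : ℝ≥0∞) ^ (T.lev x) = ENNReal.ofReal (T.wt x) := by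
  have hq0 : (0:ℝ) < q := by exact_mod_cast (by omega : 0 < q)
  have e : T.wt x = (((q : ℝ≥0) ^ (T.lev x) : ℝ≥0) : ℝ) := by rw [wt]; push_cast; rfl
  have hq1 : (q : ℝ≥0) ≠ 0 := by exact_mod_cast (by omega : q ≠ 0)
  rw [e, ENNReal.ofReal_coe_nnreal, ENNReal.coe_zpow hq1]
  simp

noncomputable def trap (n : ℕ) (x : T.V) : T.Trapezoid where
  root := T.rt n x
  height := (2 * sc n).toNat
  degenerate := false
  height_pos := by have := sc_pos n; omega
  deg_height := by simp

lemma mem_env {n : ℕ} {x y : T.V} : y ∈ (T.trap n x).envelope ↔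
    (T.below y (T.rt n x) ∧ ((2 * sc n).toNat : ℤ) ≤ 2 * (T.lev (T.rt n x) - T.lev y) ∧
        T.lev (T.rt n x) - T.lev y < 4 * ((2 * sc n).toNat : ℤ)) := by
  unfold Trapezoid.envelope
  rw [if_neg (by simp [trap])]
  rfl

lemma dQ_sub {n : ℕ} (hn : 1 ≤ n) (x : T.V) : ∀ y ∈ T.dQ n x, y ∈ (T.trap n x).envelope := by
  intro y hy
  rw [mem_dQ T hn] at hy
  have h0 := sc_pos n
  have h1 := rl_bounds hn (T.lev y)
  have h2 := div_facts (T.lev y) h0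
  have h3 := T.lev_rt hn y
  rw [mem_env, ← hy.2, h3]
  refine ⟨T.below_iff.2 ⟨_, rfl⟩, ?_, ?_⟩
  · rw [Int.toNat_of_nonneg (by omega)]; omega
  · rw [Int.toNat_of_nonneg (by omega)]; omega

lemma mu_env (hq : 2 ≤ q) {n : ℕ} (hn : 1 ≤ n) (x : T.V) :
    T.mu (T.trap n x).envelope ≤ ENNReal.ofReal (8 * ∑ y ∈ T.dQ n x, T.wt y) := by
  classical
  have h0 := sc_pos n
  set E : Finset T.V := (Finset.range (8 * sc n).toNat).biUnion fun i => T.desc i (T.rt n x)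
  have hsub : (T.trap n x).envelope ⊆ (E : Set T.V) := by
    intro y hy
    rw [mem_env] at hy
    obtain ⟨hb, _, h2⟩ := hy
    obtain ⟨k, hk⟩ := T.below_iff.1 hb
    have h3 := T.lev_iter k y
    rw [hk] at h3
    rw [Int.toNat_of_nonneg (by omega)] at h2
    simp only [E, Finset.coe_biUnion, Set.mem_iUnion]
    exact ⟨k, by simp only [Finset.coe_range, Set.mem_Iio]; omega, T.mem_desc.2 hk⟩
  calc T.mu (T.trap n x).envelope
      ≤ ∑' y : (E : Set T.V), (q : ℝ≥0∞) ^ (T.lev y.1) :=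
        ENNReal.tsum_mono_subtype (fun y => (q : ℝ≥0∞) ^ (T.lev y)) hsub
    _ = ∑ y ∈ E, (q : ℝ≥0∞) ^ (T.lev y) :=
        Finset.tsum_subtype' E (fun y => (q : ℝ≥0∞) ^ (T.lev y))
    _ = ENNReal.ofReal (∑ y ∈ E, T.wt y) := by
        rw [ENNReal.ofReal_sum_of_nonneg (fun y _ => (T.wt_pos hq y).le)]
        exact Finset.sum_congr rfl fun y _ => T.ofReal_wt hq y
    _ = ENNReal.ofReal (8 * ∑ y ∈ T.dQ n x, T.wt y) := by
        congr 1
        rw [sum_dQ T hq hn, Finset.sum_biUnion]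
        · simp only [sum_desc T hq, Finset.sum_const, Finset.card_range, nsmul_eq_mul]
          rw [wt, lev_rt T hn, ← mul_assoc]
          congr 1
          have := Int.toNat_of_nonneg (show 0 ≤ 8 * sc n by omega)
          exact_mod_cast this
        · intro i hi j hj hij
          rw [Function.onFun, Finset.disjoint_left]
          intro z hz1 hz2
          rw [mem_desc] at hz1 hz2
          have e1 := T.lev_iter i z
          have e2 := T.lev_iter j z
          rw [hz1] at e1
          rw [hz2] at e2
          omega

lemma H1_bound (hq : 2 ≤ q) (b : T.V → ℂ) (c : ℕ × T.V → ℝ) (a : ℕ × T.V → T.V → ℂ)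
    (n : ℕ × T.V → ℕ) (hc : ∀ i, 0 ≤ c i) (hn : ∀ i, 1 ≤ n i)
    (ha : ∀ i x, x ∉ T.dQ (n i) i.2 → a i x = 0)
    (hab : ∀ i x, ‖a i x‖ ≤ (∑ y ∈ T.dQ (n i) i.2, T.wt y)⁻¹)
    (hai : ∀ i, ∑ y ∈ T.dQ (n i) i.2, T.wt y • a i y = 0)
    (hb : ∀ x, HasSum (fun i => (c i : ℂ) * a i x) (b x)) (hcs : Summable c) :
    T.H1Norm b ≤ ENNReal.ofReal (8 * ∑' i, c i) := by
  have := T.countableV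
  have : Nonempty T.V := ⟨T.geo 0⟩
  obtain ⟨e⟩ := nonempty_equiv_of_countable (α := ℕ) (β := ℕ × T.V)
  unfold H1Norm
  refine (iInf₂_le (fun k => ((8 * c (e k) : ℝ) : ℂ)) (fun k x => (8:ℂ)⁻¹ * a (e k) x)).trans ?_
  refine (iInf_le _ ⟨?_, ?_⟩).trans ?_
  rotate_left
  · intro k
    refine ⟨T.trap (n (e k)) (e k).2, ?_, ?_, ?_⟩
    · intro x hx
      by_contra hx'
      apply hx
      simp only
      rw [ha, mul_zero]
      exact fun h => hx' (T.dQ_sub (hn _) _ x h)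
    · intro x
      set M := ∑ y ∈ T.dQ (n (e k)) (e k).2, T.wt y with hM
      have hM0 : 0 < M := ((T.dyad hq).m_pos (n (e k)) (e k).2 :)
      refine le_trans ?_ (ENNReal.inv_le_inv.2 (T.mu_env hq (hn (e k)) (e k).2))
      rw [← ENNReal.ofReal_inv_of_pos (by positivity), ← enorm_eq_nnnorm, ← ofReal_norm]
      apply ENNReal.ofReal_le_ofReal
      rw [norm_mul, mul_inv]
      have := hab (e k) x
      have h8 : ‖(8:ℂ)⁻¹‖ = (8:ℝ)⁻¹ := by simp
      rw [h8]
      gcongr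
    · rw [tsum_eq_sum (s := T.dQ (n (e k)) (e k).2)]
      · have h := hai (e k)
        have h2 : ∀ y ∈ T.dQ (n (e k)) (e k).2, (8:ℂ)⁻¹ * a (e k) y * (q:ℂ) ^ T.lev y =
            (8:ℂ)⁻¹ * (T.wt y • a (e k) y) := by
          intro y _
          rw [Complex.real_smul, wt]
          push_cast
          ring
        rw [Finset.sum_congr rfl h2, ← Finset.mul_sum, h, mul_zero]
      · intro y hy
        simp only [ha _ _ hy]; simp
  · intro x
    have h := (e.hasSum_iff (f := fun i => (c i : ℂ) * a i x)).2 (hb x)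
    refine h.congr_fun ?_
    intro k
    simp only [Function.comp]
    push_cast
    ring
  · have h1 : ∀ k, (‖((8 * c (e k) : ℝ) : ℂ)‖₊ : ℝ≥0∞) = ENNReal.ofReal (8 * c (e k)) := by
      intro k
      rw [← enorm_eq_nnnorm, ← ofReal_norm, Complex.norm_real,
        Real.norm_of_nonneg (mul_nonneg (by norm_num) (hc _))]
    simp only [h1]
    rw [e.tsum_eq (fun i => ENNReal.ofReal (8 * c i)), ← tsum_mul_left,
      ENNReal.ofReal_tsum_of_nonneg (fun i => mul_nonneg (by norm_num) (hc i)) (hcs.mul_left 8)]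

lemma term_eq (hq : 2 ≤ q) (f : T.V → ℂ) {r : ℝ} (hr : 0 ≤ r) (x : T.V) :
    (‖f x‖₊ : ℝ≥0∞) ^ r * (q : ℝ≥0∞) ^ (T.lev x) = ENNReal.ofReal (T.wt x * ‖f x‖ ^ r) := by
  rw [ofReal_wt T hq, ← enorm_eq_nnnorm, ← ofReal_norm,
    ENNReal.ofReal_rpow_of_nonneg (norm_nonneg _) hr, mul_comm,
    ENNReal.ofReal_mul (T.wt_pos hq x).le]

lemma summable_of_lpPow (hq : 2 ≤ q) (f : T.V → ℂ) {r : ℝ} (hr : 0 ≤ r) (h : T.lpPow f r ≠ ⊤) :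
    Summable (fun x => T.wt x * ‖f x‖ ^ r) ∧
      T.lpPow f r = ENNReal.ofReal (∑' x, T.wt x * ‖f x‖ ^ r) := by
  have h0 : ∀ x, 0 ≤ T.wt x * ‖f x‖ ^ r := fun x =>
    mul_nonneg (T.wt_pos hq x).le (by positivity)
  unfold lpPow at *
  simp only [term_eq T hq f hr] at *
  have hs : Summable (fun x => T.wt x * ‖f x‖ ^ r) := by
    have := ENNReal.summable_toReal h
    simpa [ENNReal.toReal_ofReal (h0 _)] using this
  exact ⟨hs, (ENNReal.ofReal_tsum_of_nonneg h0 hs).symm⟩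

lemma lp1_bound (hq : 2 ≤ q) (g : T.V → ℂ) {p : ℝ} {p₁ : ℝ≥0∞} (hp : 1 < p)
    (hpp₁ : ENNReal.ofReal p < p₁) {B N : ℝ} (hB : 0 < B) (hN : 0 < N)
    (h1 : ∀ x, ‖g x‖ ^ p ≤ B) (h2 : ∀ S : Finset T.V, ∑ x ∈ S, T.wt x * ‖g x‖ ^ p ≤ N) :
    T.lpNormE p₁ g ≤ ENNReal.ofReal (B ^ (1/p - p₁.toReal⁻¹) * N ^ (p₁.toReal⁻¹)) := by
  have h3 : ∀ x, ‖g x‖ ≤ B ^ (1/p) := fun x => by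
    rw [one_div, Real.le_rpow_inv_iff_of_pos (norm_nonneg _) hB.le (by linarith)]
    exact h1 x
  unfold lpNormE
  split_ifs with ht
  · simp only [ht, ENNReal.toReal_top, inv_zero, sub_zero, Real.rpow_zero, mul_one]
    refine iSup_le fun x => ?_
    rw [← enorm_eq_nnnorm, ← ofReal_norm]
    exact ENNReal.ofReal_le_ofReal (h3 x)
  · set r := p₁.toReal with hr
    have hpr : p < r := by
      rw [← ENNReal.ofReal_toReal ht] at hpp₁
      exact (ENNReal.ofReal_lt_ofReal_iff_of_nonneg (by linarith)).1 hpp₁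
    have hr0 : 0 < r := by linarith
    have h4 : T.lpPow g r ≤ ENNReal.ofReal (B ^ ((r - p)/p) * N) := by
      unfold lpPow
      simp only [term_eq T hq g hr0.le]
      rw [ENNReal.tsum_eq_iSup_sum]
      refine iSup_le fun S => ?_
      rw [← ENNReal.ofReal_sum_of_nonneg
        (fun x _ => mul_nonneg (T.wt_pos hq x).le (by positivity))]
      apply ENNReal.ofReal_le_ofReal
      calc _ ≤ ∑ x ∈ S, B ^ ((r - p)/p) * (T.wt x * ‖g x‖ ^ p) := by
            refine Finset.sum_le_sum fun x _ => ?_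
            have hw := T.wt_pos hq x
            have e1 : ‖g x‖ ^ r = ‖g x‖ ^ p * ‖g x‖ ^ (r - p) := by
              rw [← Real.rpow_add_of_nonneg (norm_nonneg _) (by linarith) (by linarith)]
              congr 1; ring
            have e2 : ‖g x‖ ^ (r - p) ≤ B ^ ((r - p)/p) := by
              have := Real.rpow_le_rpow (norm_nonneg _) (h3 x) (by linarith : 0 ≤ r - p)
              rw [← Real.rpow_mul hB.le] at this
              convert this using 2
              ring
            rw [e1]
            calc _ ≤ T.wt x * (‖g x‖ ^ p * B ^ ((r - p)/p)) := by gcongr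
              _ = _ := by ring
        _ = B ^ ((r - p)/p) * ∑ x ∈ S, (T.wt x * ‖g x‖ ^ p) := by rw [Finset.mul_sum]
        _ ≤ _ := by
          gcongr
          exact h2 S
    calc _ ≤ (ENNReal.ofReal (B ^ ((r - p)/p) * N)) ^ r⁻¹ := ENNReal.rpow_le_rpow h4 (by positivity)
      _ = _ := by
        rw [ENNReal.ofReal_rpow_of_nonneg (by positivity) (by positivity),
          Real.mul_rpow (by positivity) hN.le, ← Real.rpow_mul hB.le]
        congr 3
        field_simp

lemma K_zero (p₁ t : ℝ≥0∞) (f : T.V → ℂ) (hp₁ : 1 < p₁) (hf : ∀ x, f x = 0) :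
    T.KH1Lp p₁ t f = 0 := by
  have h1 : T.H1Norm (fun _ => 0) = 0 := by
    unfold H1Norm
    rw [← nonpos_iff_eq_zero]
    refine (iInf₂_le (fun _ => 0) (fun _ _ => 0)).trans ?_
    refine (iInf_le _ ⟨?_, ?_⟩).trans (by simp)
    · intro k
      refine ⟨⟨T.geo 0, 1, false, le_rfl, fun _ => rfl⟩, ?_, ?_, ?_⟩
      · intro x hx
        simp at hx
      · simp
      · simp
    · intro x
      simp
  have h2 : T.lpNormE p₁ (fun _ => 0) = 0 := by
    unfold lpNormE
    split_ifs with h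
    · simp
    · have hr : 0 < p₁.toReal := ENNReal.toReal_pos (by positivity) h
      unfold lpPow
      simp [hr]
  unfold KH1Lp
  rw [← nonpos_iff_eq_zero]
  refine (iInf₂_le (fun _ => 0) (fun _ => 0)).trans ?_
  refine (iInf_le _ (by simpa using hf)).trans ?_
  rw [h1, h2]; simp

lemma s_calc {N t p u θ : ℝ} (hN : 0 < N) (ht : 0 < t) (hu : u < 1)
    (hrel : 1 / p = (1 - θ) + θ * u) :
    (N * t ^ (-(1 - u)⁻¹)) ^ (1/p - 1) * N = N ^ (1/p) * t ^ θ ∧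
    t * ((N * t ^ (-(1 - u)⁻¹)) ^ (1/p - u) * N ^ u) = N ^ (1/p) * t ^ θ := by
  have hu' : 1 - u ≠ 0 := by linarith
  have e : ∀ v : ℝ, (N * t ^ (-(1 - u)⁻¹)) ^ v = N ^ v * t ^ (-(1 - u)⁻¹ * v) := by
    intro v
    rw [Real.mul_rpow hN.le (by positivity), ← Real.rpow_mul ht.le]
  rw [e, e]
  constructor
  · have h1 : N ^ (1/p - 1) * N = N ^ (1/p) := by
      rw [Real.rpow_sub hN, Real.rpow_one]; field_simp
    have h2 : -(1 - u)⁻¹ * (1/p - 1) = θ := by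
      rw [hrel]; field_simp; ring
    rw [h2, ← h1]; ring
  · have h1 : N ^ (1/p - u) * N ^ u = N ^ (1/p) := by
      rw [← Real.rpow_add hN]; congr 1; ring
    have h2 : -(1 - u)⁻¹ * (1/p - u) + 1 = θ := by
      rw [hrel]; field_simp; ring
    rw [← h1, ← h2, Real.rpow_add ht, Real.rpow_one]; ring

end HomTree

/-- for `1 < p < p₁ ≤ ∞` and `θ ∈ (0,1)` with `1/p = (1-θ) + θ/p₁`,
every `f ∈ L^p(μ)` satisfies `K(t,f;H¹(μ),L^{p₁}(μ)) ≤ C t^θ ‖f‖_{L^p}` for all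
`t > 0`; consequently `f ∈ [H¹(μ),L^{p₁}(μ)]_{θ,∞}` with `‖f‖_{θ,∞} ≤ C ‖f‖_{L^p}`. -/
theorem K_functional_bound {q : ℕ} (hq : 2 ≤ q) (p : ℝ) (p₁ : ℝ≥0∞) (θ : ℝ)
    (hp : 1 < p) (hpp₁ : ENNReal.ofReal p < p₁) (hθ0 : 0 < θ) (hθ1 : θ < 1)
    (hrel : 1 / p = (1 - θ) + θ * (p₁.toReal)⁻¹) :
    ∃ C : ℝ≥0, 0 < C ∧ ∀ (T : HomTree q) (f : T.V → ℂ), T.lpPow f p ≠ ⊤ →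
      (∀ t : ℝ≥0∞, 0 < t → t ≠ ⊤ →
        T.KH1Lp p₁ t f ≤ (C : ℝ≥0∞) * t ^ θ * T.lpNormE (ENNReal.ofReal p) f) ∧
      (⨆ (t : ℝ≥0∞) (_ : 0 < t) (_ : t ≠ ⊤), T.KH1Lp p₁ t f / t ^ θ) ≤
        (C : ℝ≥0∞) * T.lpNormE (ENNReal.ofReal p) f := by
  have hu0 : 0 ≤ p₁.toReal⁻¹ := by positivity
  have h1p : 1 < p₁ := lt_trans (by simpa using hp) hpp₁
  have hu1 : p₁.toReal⁻¹ < 1 := by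
    by_cases ht : p₁ = ⊤
    · simp [ht]
    · apply inv_lt_one_of_one_lt₀
      have := (ENNReal.toReal_lt_toReal ENNReal.one_ne_top ht).2 h1p
      simpa using this
  set u := p₁.toReal⁻¹ with hu
  have hq0 : (0:ℝ) < q := by exact_mod_cast (by omega : 0 < q)
  set Cq : ℝ := 2 * (q:ℝ) ^ 2 with hCq
  have hCq0 : 0 < Cq := by positivity
  have hr1 : (2:ℝ) ^ (1 - p) < 1 := Real.rpow_lt_one_of_one_lt_of_neg (by norm_num) (by linarith)
  set C₁ : ℝ := 4 * Cq ^ (1/p) / (1 - 2 ^ (1 - p)) with hC₁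
  have hC₁0 : 0 < C₁ := div_pos (by positivity) (by linarith)
  set C : ℝ := 8 * C₁ + Cq ^ (1/p - u) with hC
  have hC0 : 0 < C := by positivity
  refine ⟨C.toNNReal, by simpa using hC0, ?_⟩
  intro T f hf
  have main : ∀ t : ℝ≥0∞, 0 < t → t ≠ ⊤ →
      T.KH1Lp p₁ t f ≤ (C.toNNReal : ℝ≥0∞) * t ^ θ * T.lpNormE (ENNReal.ofReal p) f := by
    intro t ht0 ht
    obtain ⟨hsum, hNeq⟩ := T.summable_of_lpPow hq f (r := p) (by linarith) hf
    have hterm : ∀ x, 0 ≤ T.wt x * ‖f x‖ ^ p := fun x =>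
      mul_nonneg (T.wt_pos hq x).le (by positivity)
    rcases (tsum_nonneg hterm).eq_or_lt with hN | hN
    · have hz : ∀ x, f x = 0 := by
        intro x
        have h1 := hsum.le_tsum x (fun y _ => hterm y)
        rw [← hN] at h1
        have h2 := le_antisymm h1 (hterm x)
        rcases mul_eq_zero.1 h2 with h3 | h3
        · exact absurd h3 (T.wt_pos hq x).ne'
        · rw [Real.rpow_eq_zero (norm_nonneg _) (by linarith)] at h3
          simpa using h3
      rw [T.K_zero p₁ t f h1p hz]
      exact zero_le
    · set N := ∑' x, T.wt x * ‖f x‖ ^ p with hNdef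
      set τ := t.toReal with hτ
      have hτ0 : 0 < τ := ENNReal.toReal_pos ht0.ne' ht
      have htτ : t = ENNReal.ofReal τ := (ENNReal.ofReal_toReal ht).symm
      set s : ℝ := N * τ ^ (-(1 - u)⁻¹) with hs
      have hs0 : 0 < s := by positivity
      obtain ⟨g, c, a, n, hc, hn, ha, hab, hai, hb, hcs, hct, hg1, hg2⟩ :=
        (T.dyad hq).decomp f hp hs0 hsum
      have hH := T.H1_bound hq (fun x => f x - g x) c a n hc hn ha hab hai hb hcs
      have hL := T.lp1_bound hq g hp hpp₁ (mul_pos hCq0 hs0) hN hg1 hg2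
      obtain ⟨hs1, hs2⟩ := s_calc hN hτ0 hu1 hrel
      have hnorm : T.lpNormE (ENNReal.ofReal p) f = ENNReal.ofReal (N ^ (1/p)) := by
        unfold lpNormE
        rw [if_neg ENNReal.ofReal_ne_top, ENNReal.toReal_ofReal (by linarith), hNeq,
          ENNReal.ofReal_rpow_of_nonneg hN.le (by positivity), one_div]
      have hK : T.KH1Lp p₁ t f ≤ T.H1Norm (fun x => f x - g x) + t * T.lpNormE p₁ g := by
        unfold KH1Lp
        refine (iInf₂_le (fun x => f x - g x) g).trans ?_
        exact iInf_le _ (by simp)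
      refine hK.trans ((add_le_add hH (mul_le_mul_right hL t)).trans ?_)
      rw [hnorm, htτ, ENNReal.ofReal_rpow_of_nonneg hτ0.le hθ0.le,
        ← ENNReal.ofReal_mul hτ0.le, ← ENNReal.ofReal_add
          (mul_nonneg (by norm_num) (tsum_nonneg hc)) (by positivity)]
      change _ ≤ ENNReal.ofReal C * _ * _
      rw [← ENNReal.ofReal_mul hC0.le, ← ENNReal.ofReal_mul (by positivity)]
      apply ENNReal.ofReal_le_ofReal
      rw [← hu, Real.mul_rpow hCq0.le hs0.le]
      calc _ ≤ 8 * (C₁ * s ^ (1/p - 1) * N) + τ * (Cq ^ (1/p - u) * s ^ (1/p - u) * N ^ u) := by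
            gcongr
        _ = 8 * C₁ * (s ^ (1/p - 1) * N) + Cq ^ (1/p - u) * (τ * (s ^ (1/p - u) * N ^ u)) := by
            ring
        _ = _ := by rw [hs1, hs2, hC]; ring
  refine ⟨main, ?_⟩
  refine iSup_le fun t => iSup_le fun ht0 => iSup_le fun ht => ?_
  apply ENNReal.div_le_of_le_mul
  refine (main t ht0 ht).trans (le_of_eq ?_)
  ring
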